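/- arXiv:2506.11900 — 2 statements merged into one kernel-verified Lean document; each statement's English description precedes it below -/
import Mathlib

section
/- Local nondeterminism of Gaussian-Volterra bridges (analytic form). Let T > 0, let 0 ≤ ξ ≤ t ≤ T, and let f, g : [0,T] → ℝ be measurable and square integrable on [0,T], with ∫_t^T g(u)² du > 0. For s ∈ [ξ,t] define ĥ(s) = g(s) · (∫_s^t f(r) g(r) dr) / (∫_s^T g(u)² du). Then ∫_ξ^t (f(s) − ĥ(s))² ds ≥ (∫_ξ^t f(s)² ds) · (∫_t^T g(r)² dr) / (∫_ξ^T g(u)² du). -/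
open MeasureTheory intervalIntegral

/-- The inverse of an absolutely continuous function that is bounded below by a positive constant
is absolutely continuous. -/
theorem AbsolutelyContinuousOnInterval.inv_of_le {G : ℝ → ℝ} {a b c : ℝ}
    (hG : AbsolutelyContinuousOnInterval G a b) (hc : 0 < c) (hcG : ∀ x ∈ Set.uIcc a b, c ≤ G x) :
    AbsolutelyContinuousOnInterval (fun x => (G x)⁻¹) a b := by
  rw [absolutelyContinuousOnInterval_iff] at hG ⊢
  intro ε hε
  obtain ⟨δ, hδ, h⟩ := hG (ε * c ^ 2) (by positivity)
  refine ⟨δ, hδ, fun E hE hE' => ?_⟩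
  have h_sum : (∑ i ∈ Finset.range E.1, dist (G (E.2 i).1)⁻¹ (G (E.2 i).2)⁻¹)
      ≤ (∑ i ∈ Finset.range E.1, dist (G (E.2 i).1) (G (E.2 i).2)) / c ^ 2 := by
    rw [Finset.sum_div]
    refine Finset.sum_le_sum fun i hi => ?_
    have h1 := hcG _ (hE.1 i hi).1
    have h2 := hcG _ (hE.1 i hi).2
    rw [dist_inv_inv₀ (hc.trans_le h1).ne' (hc.trans_le h2).ne', Real.norm_eq_abs,
      Real.norm_eq_abs, abs_of_pos (hc.trans_le h1), abs_of_pos (hc.trans_le h2), sq]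
    have := hc.trans_le h1
    gcongr
  exact h_sum.trans_lt ((div_lt_iff₀ (by positivity)).2 (h E hE hE'))

/-- The product of two square integrable functions on an interval is integrable. -/
theorem intervalIntegrable_mul_of_sq {f g : ℝ → ℝ} {a b : ℝ}
    (hf : Measurable f) (hg : Measurable g)
    (hf2 : IntervalIntegrable (fun x => f x ^ 2) volume a b)
    (hg2 : IntervalIntegrable (fun x => g x ^ 2) volume a b) :
    IntervalIntegrable (fun x => f x * g x) volume a b := by
  refine (hf2.add hg2).mono_fun (hf.mul hg).aestronglyMeasurable (Filter.Eventually.of_forall ?_)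
  intro x
  simp only [Real.norm_eq_abs, abs_mul]
  refine le_trans ?_ (le_abs_self _)
  nlinarith [sq_nonneg (|f x| - |g x|), sq_abs (f x), sq_abs (g x), sq_nonneg (f x),
    sq_nonneg (g x)]

/-- The Cauchy–Schwarz inequality for interval integrals. -/
theorem sq_intervalIntegral_mul_le {f g : ℝ → ℝ} {a b : ℝ} (hab : a ≤ b)
    (hf : Measurable f) (hg : Measurable g)
    (hf2 : IntervalIntegrable (fun x => f x ^ 2) volume a b)
    (hg2 : IntervalIntegrable (fun x => g x ^ 2) volume a b) :
    (∫ x in a..b, f x * g x) ^ 2 ≤ (∫ x in a..b, f x ^ 2) * ∫ x in a..b, g x ^ 2 := by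
  have hfg := intervalIntegrable_mul_of_sq hf hg hf2 hg2
  have h_quad : ∀ l : ℝ, 0 ≤ (∫ x in a..b, g x ^ 2) * (l * l)
      + (2 * ∫ x in a..b, f x * g x) * l + ∫ x in a..b, f x ^ 2 := by
    intro l
    have h_exp : ∫ x in a..b, (f x + l * g x) ^ 2 = (∫ x in a..b, g x ^ 2) * (l * l)
        + (2 * ∫ x in a..b, f x * g x) * l + ∫ x in a..b, f x ^ 2 := by
      have : (fun x => (f x + l * g x) ^ 2)
          = fun x => (l * l) * g x ^ 2 + (2 * l) * (f x * g x) + f x ^ 2 := by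
        ext x; ring
      rw [this, intervalIntegral.integral_add ((hg2.const_mul _).add (hfg.const_mul _)) hf2,
        intervalIntegral.integral_add (hg2.const_mul _) (hfg.const_mul _),
        intervalIntegral.integral_const_mul, intervalIntegral.integral_const_mul]
      ring
    rw [← h_exp]
    exact intervalIntegral.integral_nonneg hab fun x _ => sq_nonneg _
  have h_discrim := discrim_le_zero h_quad
  rw [discrim] at h_discrim
  linarith

/-- The exact formula for the conditional variance of the bridge. -/
theorem intervalIntegral_sq_sub_bridge {f g : ℝ → ℝ} {ξ t T : ℝ} (hξt : ξ ≤ t) (htT : t ≤ T)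
    (hf : Measurable f) (hg : Measurable g)
    (hf2 : IntervalIntegrable (fun x => f x ^ 2) volume ξ T)
    (hg2 : IntervalIntegrable (fun x => g x ^ 2) volume ξ T)
    (hpos : 0 < ∫ u in t..T, g u ^ 2) :
    ∫ s in ξ..t, (f s - g s * (∫ r in s..t, f r * g r) / (∫ u in s..T, g u ^ 2)) ^ 2
      = (∫ s in ξ..t, f s ^ 2)
        - (∫ r in ξ..t, f r * g r) ^ 2 / ∫ u in ξ..T, g u ^ 2 := by
  have hξT := hξt.trans htT
  have hfg := intervalIntegrable_mul_of_sq hf hg hf2 hg2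
  have h_sub : Set.uIcc ξ t ⊆ Set.uIcc ξ T := by
    rw [Set.uIcc_of_le hξt, Set.uIcc_of_le hξT]
    exact Set.Icc_subset_Icc_right htT
  have ht_mem : t ∈ Set.uIcc ξ T := h_sub Set.right_mem_uIcc
  set F : ℝ → ℝ := fun s => ∫ r in s..t, f r * g r with hF
  set G : ℝ → ℝ := fun s => ∫ u in s..T, g u ^ 2 with hG
  have hF_neg : F = fun s => -∫ r in t..s, f r * g r :=
    funext fun s => intervalIntegral.integral_symm _ _
  have hG_neg : G = fun s => -∫ u in T..s, g u ^ 2 :=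
    funext fun s => intervalIntegral.integral_symm _ _
  have hG_le : ∀ s ∈ Set.uIcc ξ t, G t ≤ G s := by
    intro s hs
    rw [Set.uIcc_of_le hξt] at hs
    exact intervalIntegral.integral_mono_interval hs.2 htT le_rfl
      (Filter.Eventually.of_forall fun x => sq_nonneg (g x))
      (hg2.mono_set (by
        rw [Set.uIcc_of_le hξT, Set.uIcc_of_le (hs.2.trans htT)]
        exact Set.Icc_subset_Icc_left hs.1))
  have hF_ac : AbsolutelyContinuousOnInterval F ξ t := by
    rw [hF_neg]
    exact ((hfg.absolutelyContinuousOnInterval_intervalIntegral ht_mem).mono h_sub).neg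
  have hG_ac : AbsolutelyContinuousOnInterval G ξ t := by
    rw [hG_neg]
    exact ((hg2.absolutelyContinuousOnInterval_intervalIntegral Set.right_mem_uIcc).mono h_sub).neg
  have hH_ac : AbsolutelyContinuousOnInterval (fun s => F s * F s * (G s)⁻¹) ξ t :=
    (hF_ac.fun_mul hF_ac).fun_mul (hG_ac.inv_of_le hpos hG_le)
  have h_ae : ∀ᵐ s, s ∈ Set.uIoc ξ t → (f s - g s * F s / G s) ^ 2
      = f s ^ 2 + deriv (fun s => F s * F s * (G s)⁻¹) s := by
    filter_upwards [hfg.ae_hasDerivAt_integral, hg2.ae_hasDerivAt_integral] with s hs1 hs2 hs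
    have hs' := Set.uIoc_subset_uIcc hs
    have hG_ne : G s ≠ 0 := (hpos.trans_le (hG_le s hs')).ne'
    have hF_deriv : HasDerivAt F (-(f s * g s)) s := by
      rw [hF_neg]
      exact (hs1 (h_sub hs') t ht_mem).neg
    have hG_deriv : HasDerivAt G (-(g s ^ 2)) s := by
      rw [hG_neg]
      exact (hs2 (h_sub hs') T Set.right_mem_uIcc).neg
    have hH_deriv := (hF_deriv.fun_mul hF_deriv).fun_mul (hG_deriv.fun_inv hG_ne)
    rw [hH_deriv.deriv]
    field_simp
    ring
  rw [intervalIntegral.integral_congr_ae h_ae,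
    intervalIntegral.integral_add (hf2.mono_set h_sub) hH_ac.intervalIntegrable_deriv,
    hH_ac.integral_deriv_eq_sub]
  have hFt : F t = 0 := intervalIntegral.integral_same
  rw [hFt]
  ring

/-- Local nondeterminism of Gaussian–Volterra bridges (analytic form):
if `f, g` are measurable and square integrable on `[0, T]`, `0 ≤ ξ ≤ t ≤ T` and
`∫_t^T g² > 0`, then with `ĥ(s) = g(s) (∫_s^t f g) / (∫_s^T g²)` one has
`∫_ξ^t (f - ĥ)² ≥ (∫_ξ^t f²) (∫_t^T g²) / (∫_ξ^T g²)`. -/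
theorem bridge_local_nondeterminism
    (T : ℝ) (hT : 0 < T) (ξ t : ℝ) (hξ : 0 ≤ ξ) (hξt : ξ ≤ t) (htT : t ≤ T)
    (f g : ℝ → ℝ) (hf : Measurable f) (hg : Measurable g)
    (hf2 : IntervalIntegrable (fun x => (f x) ^ 2) volume 0 T)
    (hg2 : IntervalIntegrable (fun x => (g x) ^ 2) volume 0 T)
    (hpos : 0 < ∫ u in t..T, (g u) ^ 2) :
    (∫ s in ξ..t, (f s) ^ 2) * (∫ r in t..T, (g r) ^ 2) / (∫ u in ξ..T, (g u) ^ 2)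
      ≤ ∫ s in ξ..t,
          (f s - g s * (∫ r in s..t, f r * g r) / (∫ u in s..T, (g u) ^ 2)) ^ 2 := by
  have h_sub : Set.uIcc ξ T ⊆ Set.uIcc 0 T := by
    rw [Set.uIcc_of_le (hξt.trans htT), Set.uIcc_of_le hT.le]
    exact Set.Icc_subset_Icc_left hξ
  have hf2' := hf2.mono_set h_sub
  have hg2' := hg2.mono_set h_sub
  have h_sub_left : Set.uIcc ξ t ⊆ Set.uIcc ξ T := by
    rw [Set.uIcc_of_le hξt, Set.uIcc_of_le (hξt.trans htT)]
    exact Set.Icc_subset_Icc_right htT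
  have h_sub_right : Set.uIcc t T ⊆ Set.uIcc ξ T := by
    rw [Set.uIcc_of_le htT, Set.uIcc_of_le (hξt.trans htT)]
    exact Set.Icc_subset_Icc_left hξt
  rw [intervalIntegral_sq_sub_bridge hξt htT hf hg hf2' hg2' hpos]
  have h_cs := sq_intervalIntegral_mul_le hξt hf hg (hf2'.mono_set h_sub_left)
    (hg2'.mono_set h_sub_left)
  have h_split := intervalIntegral.integral_add_adjacent_intervals (hg2'.mono_set h_sub_left)
    (hg2'.mono_set h_sub_right)
  have h_nonneg : 0 ≤ ∫ u in ξ..t, (g u) ^ 2 :=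
    intervalIntegral.integral_nonneg hξt fun x _ => sq_nonneg _
  have hG_pos : 0 < ∫ u in ξ..T, (g u) ^ 2 := by linarith
  rw [le_sub_iff_add_le, ← add_div, div_le_iff₀ hG_pos, ← h_split, mul_add]
  linarith
end

section
/- Local nondeterminism of the fractional Brownian bridge (analytic form). Let T > 0, H ∈ (0,1), c_H > 0, and let K : [0,T]² → ℝ be a measurable kernel such that K(t,s) = 0 for s > t, K(t,·) is square integrable on [0,T] for every t, and ∫_s^t K(t,u)² du = c_H (t−s)^{2H} for all 0 ≤ s ≤ t ≤ T. For 0 ≤ ξ ≤ t < T define, for s ∈ [ξ,t], K̃^T(t,s) = K(t,s) − K(T,s) (∫_s^t K(t,r) K(T,r) dr) / (∫_s^T K(T,u)² du). Then ∫_ξ^t K̃^T(t,s)² ds ≥ c_H (t−ξ)^{2H} (T−t)^{2H} / (T−ξ)^{2H}. -/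
open MeasureTheory intervalIntegral

open Set in
/-- The inverse of an absolutely continuous function bounded away from zero is absolutely
continuous. -/
theorem AbsolutelyContinuousOnInterval.inv_of_le_s3 {f : ℝ → ℝ} {a b m : ℝ}
    (hf : AbsolutelyContinuousOnInterval f a b) (hm : 0 < m) (hfm : ∀ x ∈ uIcc a b, m ≤ f x) :
    AbsolutelyContinuousOnInterval (fun x => (f x)⁻¹) a b := by
  rw [absolutelyContinuousOnInterval_iff] at hf ⊢
  intro ε hε
  obtain ⟨δ, hδ, h⟩ := hf (ε * m ^ 2) (by positivity)
  refine ⟨δ, hδ, fun E hE hlt => ?_⟩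
  have hsum := h E hE hlt
  have hle : ∑ i ∈ Finset.range E.1, dist (f (E.2 i).1)⁻¹ (f (E.2 i).2)⁻¹
      ≤ (∑ i ∈ Finset.range E.1, dist (f (E.2 i).1) (f (E.2 i).2)) / m ^ 2 := by
    rw [Finset.sum_div]
    refine Finset.sum_le_sum fun i hi => ?_
    have h1 := hfm _ (hE.1 i hi).1
    have h2 := hfm _ (hE.1 i hi).2
    have p1 := hm.trans_le h1
    have p2 := hm.trans_le h2
    rw [dist_inv_inv₀ p1.ne' p2.ne', Real.norm_of_nonneg p1.le, Real.norm_of_nonneg p2.le]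
    gcongr
    nlinarith
  exact hle.trans_lt ((div_lt_iff₀ (by positivity)).2 hsum)

/-- The Cauchy–Schwarz inequality for interval integrals. -/
theorem intervalIntegral.sq_integral_mul_le {a b : ℝ → ℝ} {x y : ℝ} (hxy : x ≤ y)
    (ha : IntervalIntegrable (fun s => a s ^ 2) volume x y)
    (hb : IntervalIntegrable (fun s => b s ^ 2) volume x y)
    (hab : IntervalIntegrable (fun s => a s * b s) volume x y) :
    (∫ s in x..y, a s * b s) ^ 2 ≤ (∫ s in x..y, a s ^ 2) * ∫ s in x..y, b s ^ 2 := by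
  have key : ∀ c : ℝ, 0 ≤ (∫ s in x..y, b s ^ 2) * (c * c)
      + (-2 * ∫ s in x..y, a s * b s) * c + ∫ s in x..y, a s ^ 2 := by
    intro c
    have h : 0 ≤ ∫ s in x..y, (a s - c * b s) ^ 2 := integral_nonneg hxy fun s _ => sq_nonneg _
    have e : (fun s => (a s - c * b s) ^ 2)
        = fun s => a s ^ 2 + (-2 * c) * (a s * b s) + c ^ 2 * b s ^ 2 := by
      ext s; ring
    rw [e, integral_add (ha.add (hab.const_mul _)) (hb.const_mul _),
      integral_add ha (hab.const_mul _), integral_const_mul, integral_const_mul] at h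
    linarith
  have h := discrim_le_zero key
  rw [discrim] at h
  linarith

open Set in
/-- The conditional variance of a Gaussian–Volterra bridge, as the variance of the residual of
the projection onto the terminal value. -/
theorem integral_sq_bridge_kernel {a b : ℝ → ℝ} {x t T : ℝ} (hxt : x ≤ t) (htT : t ≤ T)
    (ha : IntervalIntegrable (fun s => a s ^ 2) volume x t)
    (hb : IntervalIntegrable (fun s => b s ^ 2) volume x T)
    (hab : IntervalIntegrable (fun s => a s * b s) volume x t)
    (hpos : 0 < ∫ u in t..T, b u ^ 2) :
    ∫ s in x..t, (a s - b s * (∫ r in s..t, a r * b r) / ∫ u in s..T, b u ^ 2) ^ 2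
      = (∫ s in x..t, a s ^ 2) - (∫ s in x..t, a s * b s) ^ 2 / ∫ u in x..T, b u ^ 2 := by
  set N : ℝ → ℝ := fun s => ∫ r in s..t, a r * b r with hN
  set D : ℝ → ℝ := fun s => ∫ u in s..T, b u ^ 2 with hD
  have hsub : uIcc x t ⊆ uIcc x T := by
    rw [uIcc_of_le hxt, uIcc_of_le (hxt.trans htT)]
    exact Icc_subset_Icc_right htT
  have hN' : N = fun s => -∫ r in t..s, a r * b r := by
    ext s; exact integral_symm _ _
  have hD' : D = fun s => -∫ r in T..s, b r ^ 2 := by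
    ext s; exact integral_symm _ _
  have hNac : AbsolutelyContinuousOnInterval N x t := by
    rw [hN']
    exact (hab.absolutelyContinuousOnInterval_intervalIntegral right_mem_uIcc).neg
  have hDac : AbsolutelyContinuousOnInterval D x t := by
    rw [hD']
    exact ((hb.absolutelyContinuousOnInterval_intervalIntegral right_mem_uIcc).neg).mono hsub
  have hDle : ∀ s ∈ uIcc x t, D t ≤ D s := by
    intro s hs
    rw [uIcc_of_le hxt] at hs
    refine integral_mono_interval hs.2 htT le_rfl (ae_of_all _ fun u => sq_nonneg (b u)) ?_
    refine hb.mono_set ?_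
    rw [uIcc_of_le (hs.2.trans htT), uIcc_of_le (hxt.trans htT)]
    exact Icc_subset_Icc_left hs.1
  have hF := (hNac.fun_mul hNac).fun_mul (hDac.inv_of_le_s3 hpos hDle)
  have hderiv : ∀ᵐ s, s ∈ uIoc x t →
      (a s - b s * N s / D s) ^ 2 = a s ^ 2 + deriv (fun s => N s * N s * (D s)⁻¹) s := by
    filter_upwards [hab.ae_hasDerivAt_integral, hb.ae_hasDerivAt_integral] with s h1 h2 hs
    have hs' := uIoc_subset_uIcc hs
    have d1 : HasDerivAt N (-(a s * b s)) s := by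
      rw [hN']; exact (h1 hs' t right_mem_uIcc).neg
    have d2 : HasDerivAt D (-(b s ^ 2)) s := by
      rw [hD']; exact (h2 (hsub hs') T right_mem_uIcc).neg
    have hDs : D s ≠ 0 := (hpos.trans_le (hDle s hs')).ne'
    have d3 := (d1.fun_mul d1).fun_mul (d2.fun_inv hDs)
    rw [d3.deriv]
    field_simp
    ring
  have hNt : N t = 0 := integral_same
  rw [integral_congr_ae hderiv, integral_add ha hF.intervalIntegrable_deriv,
    hF.integral_deriv_eq_sub, hNt]
  ring

/-- Local nondeterminism of the fractional Brownian bridge (analytic form).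
If `K` is a measurable Volterra kernel with `K t s = 0` for `s > t`,
square integrable rows, and satisfying the fBm local nondeterminism identity
`∫_s^t K(t,u)² du = c_H (t-s)^{2H}`, then for `0 ≤ ξ ≤ t < T` the kernel
`K̃^T(t,s) = K(t,s) - K(T,s) (∫_s^t K(t,r) K(T,r) dr)/(∫_s^T K(T,u)² du)`
satisfies `∫_ξ^t K̃^T(t,s)² ds ≥ c_H (t-ξ)^{2H} (T-t)^{2H} / (T-ξ)^{2H}`. -/
theorem fractional_brownian_bridge_LND
    (T H cH : ℝ) (hT : 0 < T) (hH0 : 0 < H) (hH1 : H < 1) (hcH : 0 < cH)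
    (K : ℝ → ℝ → ℝ)
    (hKmeas : Measurable (fun p : ℝ × ℝ => K p.1 p.2))
    (hKzero : ∀ t s, t < s → K t s = 0)
    (hKL2 : ∀ t, IntervalIntegrable (fun s => (K t s) ^ 2) volume 0 T)
    (hLND : ∀ s t, 0 ≤ s → s ≤ t → t ≤ T →
      (∫ u in s..t, (K t u) ^ 2) = cH * (t - s) ^ (2 * H))
    (ξ t : ℝ) (hξ : 0 ≤ ξ) (hξt : ξ ≤ t) (htT : t < T) :
    cH * (t - ξ) ^ (2 * H) * (T - t) ^ (2 * H) / (T - ξ) ^ (2 * H)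
      ≤ ∫ s in ξ..t,
          (K t s - K T s * (∫ r in s..t, K t r * K T r) / (∫ u in s..T, (K T u) ^ 2)) ^ 2 := by
  have hsq : ∀ τ x y, 0 ≤ x → x ≤ y → y ≤ T →
      IntervalIntegrable (fun s => K τ s ^ 2) volume x y := by
    intro τ x y hx hxy hy
    refine (hKL2 τ).mono_set ?_
    rw [Set.uIcc_of_le hxy, Set.uIcc_of_le hT.le]
    exact Set.Icc_subset_Icc hx hy
  have ha := hsq t ξ t hξ hξt htT.le
  have hb := hsq T ξ t hξ hξt htT.le
  have hbT := hsq T t T (hξ.trans hξt) htT.le le_rfl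
  have hmeas : ∀ τ, Measurable (K τ) := fun τ => hKmeas.of_uncurry_left
  have hab : IntervalIntegrable (fun s => K t s * K T s) volume ξ t := by
    rw [intervalIntegrable_iff] at ha hb ⊢
    exact ((memLp_two_iff_integrable_sq (hmeas t).aestronglyMeasurable).2 ha).integrable_mul
      ((memLp_two_iff_integrable_sq (hmeas T).aestronglyMeasurable).2 hb)
  have hDt := hLND t T (hξ.trans hξt) htT.le le_rfl
  have hDξ := hLND ξ T hξ (hξt.trans htT.le) le_rfl
  have hA := hLND ξ t hξ hξt htT.le
  have hpos1 : 0 < (T - t) ^ (2 * H) := Real.rpow_pos_of_pos (by linarith) _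
  have hpos2 : 0 < (T - ξ) ^ (2 * H) := Real.rpow_pos_of_pos (by linarith) _
  have hpos : 0 < ∫ u in t..T, K T u ^ 2 := by rw [hDt]; positivity
  rw [integral_sq_bridge_kernel hξt htT.le ha (hb.trans hbT) hab hpos]
  have hCS := sq_integral_mul_le hξt ha hb hab
  have hadd := integral_add_adjacent_intervals hb hbT
  rw [← eq_sub_iff_add_eq] at hadd
  rw [hadd, hA, hDξ, hDt] at hCS
  rw [hA, hDξ, div_le_iff₀ hpos2, sub_mul, le_sub_comm, div_mul_eq_mul_div,
    div_le_iff₀ (by positivity)]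
  nlinarith
end
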